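/- Let 0<q<1 (with q^{1/2} the positive square root) and let a,b,c,d be nonzero complex numbers such that θ(qa²;q²) ≠ 0 and θ(−q^{1/2}abc;q) ≠ 0. Then the following quadratic-type theta function identity holds: θ(a², b²c², −b², qb²d², −qb²/(acd), −qb²; q²) − θ(b⁴, −qc/(ad), acd, −ac/d, qacd, −qa/(b²cd); q²) = [θ(−qab²cd; q²)·θ(−b²; q)/(θ(qa²; q²)·θ(−q^{1/2}abc; q))] · { θ(bc, −bc, a², q^{1/2}bd, −q^{1/2}b/(ac), −q^{1/2}d/b; q) − θ(b², −q^{1/2}a, acd, −ac/d, q^{1/2}a, −q^{1/2}a/(bc); q) }. -/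

import Mathlib

noncomputable section

/-- `qc q x = q^x := exp(x·log q)` for a real base `q` and complex exponent `x`. -/
def qc (q : ℝ) (x : ℂ) : ℂ := Complex.exp (x * Complex.log (q : ℂ))

/-- Finite q-shifted factorial `(a;p)_n`. -/
def qPoch (a p : ℂ) (n : ℕ) : ℂ := ∏ i ∈ Finset.range n, (1 - a * p ^ i)

/-- Infinite q-shifted factorial `(a;p)_∞`. -/
def qPochInf (a p : ℂ) : ℂ := ∏' i : ℕ, (1 - a * p ^ i)

/-- Very-well-poised basic hypergeometric series `₈W₇(a₀;a₁,…,a₅;p,u)`. -/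
def W8 (a0 a1 a2 a3 a4 a5 p u : ℂ) : ℂ :=
  ∑' r : ℕ, ((1 - a0 * p ^ (2 * r)) / (1 - a0)) * u ^ r *
    ((qPoch a0 p r * qPoch a1 p r * qPoch a2 p r * qPoch a3 p r * qPoch a4 p r *
        qPoch a5 p r) /
      (qPoch (p * a0 / a0) p r * qPoch (p * a0 / a1) p r * qPoch (p * a0 / a2) p r *
        qPoch (p * a0 / a3) p r * qPoch (p * a0 / a4) p r * qPoch (p * a0 / a5) p r))

/-- All the "denominator" factors of the `₈W₇` series are nonzero. -/
def W8Denom (a0 a1 a2 a3 a4 a5 p : ℂ) : Prop :=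
  1 - a0 ≠ 0 ∧ ∀ r : ℕ,
    qPoch (p * a0 / a0) p r ≠ 0 ∧ qPoch (p * a0 / a1) p r ≠ 0 ∧
    qPoch (p * a0 / a2) p r ≠ 0 ∧ qPoch (p * a0 / a3) p r ≠ 0 ∧
    qPoch (p * a0 / a4) p r ≠ 0 ∧ qPoch (p * a0 / a5) p r ≠ 0

/-- Basic hypergeometric series `₄φ₃(a₁,a₂,a₃,a₄;b₁,b₂,b₃;p,u)`. -/
def phi43 (a1 a2 a3 a4 b1 b2 b3 p u : ℂ) : ℂ :=
  ∑' j : ℕ, (qPoch a1 p j * qPoch a2 p j * qPoch a3 p j * qPoch a4 p j) * u ^ j /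
    (qPoch p p j * qPoch b1 p j * qPoch b2 p j * qPoch b3 p j)

/-- Modified Jacobi theta function `θ(u;p)`. -/
def theta (u p : ℂ) : ℂ := qPochInf u p * qPochInf (p / u) p

/-- Askey–Wilson parameter `a_s = q^{κ+λ}`. -/
def aP (q : ℝ) (k lm : ℝ) : ℂ := qc q (k + lm)

/-- Askey–Wilson parameter `b_s = -q^{κ-λ}`. -/
def bP (q : ℝ) (k lm : ℝ) : ℂ := -qc q (k - lm)

/-- Askey–Wilson parameter `c_s = q^{s/2+υ+ς}`. -/
def cP (q : ℝ) (s up sg : ℝ) : ℂ := qc q (s / 2 + up + sg)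

/-- Askey–Wilson parameter `d_s = -q^{s/2+υ-ς}`. -/
def dP (q : ℝ) (s up sg : ℝ) : ℂ := -qc q (s / 2 + up - sg)

/-- The weight `W(x,z) = q^{(κ+λ+x)(κ+υ+z)/s}`. -/
def Wgt (q s k lm up : ℝ) (x z : ℂ) : ℂ := qc q ((k + lm + x) * (k + up + z) / s)

/-- The singular term `St(x)`; dual version is obtained by swapping `lm` and `up`. -/
def St (q s k lm up sg : ℝ) (x : ℂ) : ℂ :=
  qPochInf (qc q (s + x) / aP q k lm) (qc q s) * qPochInf (qc q (s + x) / bP q k lm) (qc q s) *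
  qPochInf (qc q (s + x) / cP q s up sg) (qc q s) *
  qPochInf (qc q (s + x) / dP q s up sg) (qc q s)

/-- The series part `Ψ(x,z)` of the asymptotically free eigenfunction. -/
def Psi (q s k lm up sg : ℝ) (x z : ℂ) : ℂ :=
  (qPochInf (qc q (s + x + z) * aP q k lm / aP q k up) (qc q s) *
   qPochInf (qc q (s + x + z) * bP q k lm / aP q k up) (qc q s) *
   qPochInf (qc q (s + x + z) * cP q s up sg / aP q k up) (qc q s) *
   qPochInf (qc q (s + x + z) * aP q k up / dP q s up sg) (qc q s) *
   qPochInf (qc q (s + 2 * z)) (qc q s) *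
   qPochInf (dP q s up sg * qc q x) (qc q s) /
   qPochInf (qc q (2 * s + x + 2 * z) / dP q s up sg) (qc q s)) *
  W8 (qc q (s + x + 2 * z) / dP q s up sg) (qc q (s + z) / aP q k up)
     (qc q (s + z) / dP q s lm sg) (bP q k up * qc q z) (cP q s lm sg * qc q z)
     (qc q (s + x) / dP q s up sg) (qc q s) (dP q s up sg * qc q x)

/-- The asymptotically free eigenfunction `Φ(x,z;κ,λ,υ,ς;q,s)`. -/
def Phi (q s k lm up sg : ℝ) (x z : ℂ) : ℂ :=
  Wgt q s k lm up x z * Psi q s k lm up sg x z /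
    (St q s k lm up sg x * St q s k up lm sg z)

/-- The Askey–Wilson function `E(x,z;κ,λ,υ,ς;q,s)`. -/
def AWE (q s k lm up sg : ℝ) (x z : ℂ) : ℂ :=
  (qPochInf (aP q k up * qc q (s + z - x) / dP q s up sg) (qc q s) *
   qPochInf (aP q k up * qc q (s + z + x) / dP q s up sg) (qc q s) *
   qPochInf (aP q k lm * bP q k lm) (qc q s) *
   qPochInf (aP q k lm * cP q s up sg) (qc q s) *
   qPochInf (qc q s * aP q k lm / dP q s up sg) (qc q s)) /
  (qPochInf (qc q (s + x) / dP q s up sg) (qc q s) *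
   qPochInf (qc q (s - x) / dP q s up sg) (qc q s) *
   qPochInf (qc q (s + z) / dP q s lm sg) (qc q s) *
   qPochInf (aP q k up * bP q k up * cP q s lm sg * qc q z) (qc q s)) *
  W8 (aP q k up * bP q k up * cP q s lm sg * qc q (-s + z))
     (aP q k lm * qc q x) (aP q k lm * qc q (-x)) (aP q k up * qc q z)
     (bP q k up * qc q z) (cP q s lm sg * qc q z) (qc q s) (qc q (s - z) / dP q s lm sg)

/-- The normalized `c`-function; the dual version swaps `lm` and `up`. -/
def cF (q s k lm up sg : ℝ) (x z : ℂ) : ℂ :=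
  (theta (aP q k up * qc q (-z)) (qc q s) * theta (bP q k up * qc q (-z)) (qc q s) *
   theta (cP q s lm sg * qc q (-z)) (qc q s) *
   theta (dP q s up sg * qc q (x - z) / aP q k up) (qc q s)) /
  (Wgt q s k lm up x z *
    (theta (qc q (-(2 * z))) (qc q s) * theta (dP q s up sg * qc q x) (qc q s)))

/-- The coefficient `A(x)` of the Askey–Wilson difference operator. -/
def AOp (q s k lm up sg : ℝ) (x : ℂ) : ℂ :=
  ((1 - aP q k lm * qc q x) * (1 - bP q k lm * qc q x) * (1 - cP q s up sg * qc q x) *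
    (1 - dP q s up sg * qc q x)) /
  (aP q k up * (1 - qc q (2 * x)) * (1 - qc q (s + 2 * x)))

open Filter Topology

theorem summable_norm_mul_pow {p : ℂ} (hp : ‖p‖ < 1) (u : ℂ) :
    Summable fun i : ℕ => ‖-(u * p ^ i)‖ := by
  simpa using (summable_geometric_of_lt_one (norm_nonneg p) hp).mul_left ‖u‖

theorem multipliable_one_sub_mul_pow {p : ℂ} (hp : ‖p‖ < 1) (u : ℂ) :
    Multipliable fun i : ℕ => 1 - u * p ^ i := by
  simpa [sub_eq_add_neg] using multipliable_one_add_of_summable (summable_norm_mul_pow hp u)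

theorem tendsto_qPoch {p : ℂ} (hp : ‖p‖ < 1) (u : ℂ) :
    Tendsto (qPoch u p) atTop (𝓝 (qPochInf u p)) :=
  (multipliable_one_sub_mul_pow hp u).tendsto_prod_tprod_nat

theorem one_sub_mul_pow_self_ne_zero {p : ℂ} (hp : ‖p‖ < 1) (i : ℕ) : 1 - p * p ^ i ≠ 0 := by
  intro h
  have h' : ‖p ^ (i + 1)‖ < 1 := by
    rw [norm_pow]
    exact pow_lt_one₀ (norm_nonneg p) hp (Nat.succ_ne_zero i)
  rw [pow_succ', ← sub_eq_zero.mp h, norm_one] at h'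
  exact lt_irrefl _ h'

theorem qPoch_self_ne_zero {p : ℂ} (hp : ‖p‖ < 1) (n : ℕ) : qPoch p p n ≠ 0 :=
  Finset.prod_ne_zero_iff.mpr fun i _ => one_sub_mul_pow_self_ne_zero hp i

theorem qPochInf_self_ne_zero {p : ℂ} (hp : ‖p‖ < 1) : qPochInf p p ≠ 0 := by
  have := tprod_one_add_ne_zero_of_summable (f := fun i : ℕ => -(p * p ^ i))
    (fun i => by simpa [sub_eq_add_neg] using one_sub_mul_pow_self_ne_zero hp i)
    (summable_norm_mul_pow hp p)
  simpa [qPochInf, sub_eq_add_neg] using this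

theorem qPochInf_eq_mul_shift {p : ℂ} (hp : ‖p‖ < 1) (u : ℂ) :
    qPochInf u p = (1 - u) * qPochInf (p * u) p := by
  have h : (fun i : ℕ => 1 - p * u * p ^ i) = fun i : ℕ => 1 - u * p ^ (i + 1) := by
    funext i; ring
  have hm := multipliable_one_sub_mul_pow hp (p * u)
  rw [h] at hm
  have hprod := tprod_eq_zero_mul' (f := fun i : ℕ => 1 - u * p ^ i) hm
  rw [pow_zero, mul_one] at hprod
  rw [qPochInf, qPochInf, h]
  exact hprod

theorem norm_sq_lt_one {p : ℂ} (hp : ‖p‖ < 1) : ‖p ^ 2‖ < 1 := by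
  rw [norm_pow]
  exact pow_lt_one₀ (norm_nonneg p) hp two_ne_zero

theorem qPochInf_eq_sq_base {p : ℂ} (hp : ‖p‖ < 1) (u : ℂ) :
    qPochInf u p = qPochInf u (p ^ 2) * qPochInf (p * u) (p ^ 2) := by
  have he : (fun i : ℕ => 1 - u * (p ^ 2) ^ i) = fun i : ℕ => 1 - u * p ^ (2 * i) := by
    funext i; rw [pow_mul]
  have ho : (fun i : ℕ => 1 - p * u * (p ^ 2) ^ i) = fun i : ℕ => 1 - u * p ^ (2 * i + 1) := by
    funext i; ring
  have hme := multipliable_one_sub_mul_pow (norm_sq_lt_one hp) u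
  have hmo := multipliable_one_sub_mul_pow (norm_sq_lt_one hp) (p * u)
  rw [he] at hme
  rw [ho] at hmo
  rw [qPochInf, qPochInf, qPochInf, he, ho]
  exact (tprod_even_mul_odd (f := fun i : ℕ => 1 - u * p ^ i) hme hmo).symm

theorem qPochInf_sq {p : ℂ} (hp : ‖p‖ < 1) (u : ℂ) :
    qPochInf (u ^ 2) (p ^ 2) = qPochInf u p * qPochInf (-u) p := by
  rw [qPochInf, qPochInf, qPochInf, ← (multipliable_one_sub_mul_pow hp u).tprod_mul
    (multipliable_one_sub_mul_pow hp (-u))]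
  congr 1
  funext i
  ring

theorem theta_div {p : ℂ} (hp0 : p ≠ 0) (u : ℂ) : theta (p / u) p = theta u p := by
  rw [theta, theta, div_div_cancel₀ hp0, mul_comm]

theorem theta_inv {p u : ℂ} (hp : ‖p‖ < 1) (hu : u ≠ 0) : theta u⁻¹ p = -theta u p / u := by
  rw [theta, theta, qPochInf_eq_mul_shift hp u⁻¹, qPochInf_eq_mul_shift hp u, div_inv_eq_mul,
    ← div_eq_mul_inv]
  field_simp
  ring

theorem theta_mul {p u : ℂ} (hp : ‖p‖ < 1) (hp0 : p ≠ 0) (hu : u ≠ 0) :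
    theta (p * u) p = -theta u p / u := by
  rw [← theta_inv hp hu, ← theta_div hp0 u⁻¹, div_inv_eq_mul]

theorem theta_eq_sq_base {p u : ℂ} (hp : ‖p‖ < 1) (hp0 : p ≠ 0) (hu : u ≠ 0) :
    theta u p = theta u (p ^ 2) * theta (p * u) (p ^ 2) := by
  have h1 : p ^ 2 / u = p * (p / u) := by ring
  have h2 : p ^ 2 / (p * u) = p / u := by field_simp
  rw [theta, theta, theta, h1, h2, qPochInf_eq_sq_base hp u, qPochInf_eq_sq_base hp (p / u)]
  ring

theorem theta_sq {p : ℂ} (hp : ‖p‖ < 1) (u : ℂ) :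
    theta (u ^ 2) (p ^ 2) = theta u p * theta (-u) p := by
  rw [theta, theta, theta, qPochInf_sq hp, ← div_pow, qPochInf_sq hp, div_neg]
  ring

/-- Gaussian binomial coefficient. -/
def gaussBinom (p : ℂ) (n k : ℕ) : ℂ :=
  if k ≤ n then qPoch p p n / (qPoch p p k * qPoch p p (n - k)) else 0

theorem gaussBinom_zero {p : ℂ} (hp : ‖p‖ < 1) (n : ℕ) : gaussBinom p n 0 = 1 := by
  have h0 : qPoch p p 0 = 1 := by simp [qPoch]
  simp [gaussBinom, h0, qPoch_self_ne_zero hp n]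

theorem gaussBinom_succ_succ {p : ℂ} (hp : ‖p‖ < 1) {n k : ℕ} (hk : k ≤ n) :
    gaussBinom p (n + 1) (k + 1) = gaussBinom p n (k + 1) + p ^ (n - k) * gaussBinom p n k := by
  have hsucc : ∀ m, qPoch p p (m + 1) = qPoch p p m * (1 - p * p ^ m) := fun m =>
    Finset.prod_range_succ _ _
  rcases hk.eq_or_lt with rfl | hlt
  · have h1 := qPoch_self_ne_zero hp k
    have h2 := qPoch_self_ne_zero hp (k + 1)
    have h3 : qPoch p p 0 = 1 := by simp [qPoch]
    simp [gaussBinom, h1, h2, h3]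
  · obtain ⟨j, rfl⟩ := Nat.exists_eq_add_of_lt hlt
    have e1 : k + j + 1 + 1 - (k + 1) = j + 1 := by omega
    have e2 : k + j + 1 - (k + 1) = j := by omega
    have e3 : k + j + 1 - k = j + 1 := by omega
    rw [gaussBinom, gaussBinom, gaussBinom, if_pos (by omega), if_pos (by omega),
      if_pos (by omega), e1, e2, e3, hsucc (k + j + 1), hsucc k, hsucc j]
    have h1 := qPoch_self_ne_zero hp k
    have h2 := qPoch_self_ne_zero hp j
    have h3 := one_sub_mul_pow_self_ne_zero hp k
    have h4 := one_sub_mul_pow_self_ne_zero hp j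
    field_simp
    ring

/-- The `q`-binomial theorem. -/
theorem prod_one_add_mul_pow {p : ℂ} (hp : ‖p‖ < 1) (x : ℂ) (n : ℕ) :
    ∏ i ∈ Finset.range n, (1 + x * p ^ i) =
      ∑ k ∈ Finset.range (n + 1), p ^ (k.choose 2) * gaussBinom p n k * x ^ k := by
  induction n with
  | zero => simp [gaussBinom_zero hp]
  | succ n ih =>
    have htop : p ^ ((n + 1).choose 2) * gaussBinom p n (n + 1) * x ^ (n + 1) = 0 := by
      simp [gaussBinom]
    have hstep : ∀ k ∈ Finset.range (n + 1),
        p ^ ((k + 1).choose 2) * gaussBinom p (n + 1) (k + 1) * x ^ (k + 1) =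
          p ^ ((k + 1).choose 2) * gaussBinom p n (k + 1) * x ^ (k + 1) +
            p ^ (k.choose 2) * gaussBinom p n k * x ^ k * (x * p ^ n) := by
      intro k hk
      have hkn : k ≤ n := Nat.lt_succ_iff.mp (Finset.mem_range.mp hk)
      have hexp : p ^ n = p ^ k * p ^ (n - k) := by rw [← pow_add, Nat.add_sub_cancel' hkn]
      have hch : (k + 1).choose 2 = k + k.choose 2 := by
        rw [Nat.choose_succ_succ' k 1, Nat.choose_one_right]
      rw [gaussBinom_succ_succ hp hkn, hexp, hch]
      ring
    have hshift := Finset.sum_range_succ'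
      (fun k => p ^ (k.choose 2) * gaussBinom p n k * x ^ k) (n + 1)
    rw [Finset.sum_range_succ, htop, add_zero] at hshift
    rw [Finset.prod_range_succ, ih, mul_add, mul_one, Finset.sum_range_succ' _ (n + 1),
      Finset.sum_congr rfl hstep, Finset.sum_add_distrib, ← Finset.sum_mul, gaussBinom_zero hp]
    nth_rewrite 1 [hshift]
    rw [gaussBinom_zero hp]
    ring

theorem two_mul_triangle (m : ℤ) : 2 * (m * (m - 1) / 2) = m * (m - 1) :=
  Int.mul_ediv_cancel' (Int.even_mul_pred_self m).two_dvd

theorem two_mul_cast_choose_two (k : ℕ) : 2 * ((k.choose 2 : ℕ) : ℤ) = k * (k - 1) := by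
  induction k with
  | zero => simp
  | succ k ih =>
    rw [Nat.choose_succ_succ' k 1, Nat.choose_one_right]
    push_cast
    linarith

/-- General term of the bilateral theta series, normalised so that
`∑ thetaTerm p v m = (p; p)_∞ θ(-v; p)`. -/
def thetaTerm (p v : ℂ) (m : ℤ) : ℂ := p ^ (m * (m - 1) / 2) * v ^ m

/-- The bilateral theta series. -/
def thetaSeries (p v : ℂ) : ℂ := ∑' m : ℤ, thetaTerm p v m

theorem summable_thetaTerm_nat {p v : ℂ} (hp : ‖p‖ < 1) (hp0 : p ≠ 0) (hv : v ≠ 0) :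
    Summable fun n : ℕ => thetaTerm p v n := by
  have hne : ∀ n : ℕ, thetaTerm p v n ≠ 0 := fun n =>
    mul_ne_zero (zpow_ne_zero _ hp0) (zpow_ne_zero _ hv)
  have hratio : ∀ n : ℕ, thetaTerm p v (n + 1 : ℕ) = thetaTerm p v n * (p ^ n * v) := by
    intro n
    have hexp : ((n + 1 : ℕ) : ℤ) * (((n + 1 : ℕ) : ℤ) - 1) / 2 = (n : ℤ) * (n - 1) / 2 + n := by
      have h1 := two_mul_triangle ((n + 1 : ℕ) : ℤ)
      have h2 := two_mul_triangle (n : ℤ)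
      push_cast at h1 ⊢
      linarith
    rw [thetaTerm, thetaTerm, hexp, zpow_add₀ hp0, zpow_natCast, Nat.cast_succ,
      zpow_add_one₀ hv]
    ring
  refine summable_of_ratio_test_tendsto_lt_one zero_lt_one (.of_forall hne) ?_
  have hlim : Tendsto (fun n : ℕ => ‖p‖ ^ n * ‖v‖) atTop (𝓝 0) := by
    simpa using (tendsto_pow_atTop_nhds_zero_of_lt_one (norm_nonneg p) hp).mul_const ‖v‖
  refine hlim.congr fun n => ?_
  rw [hratio, norm_mul, norm_mul, norm_pow, mul_div_cancel_left₀ _ (norm_ne_zero_iff.mpr (hne n))]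

theorem summable_thetaTerm {p v : ℂ} (hp : ‖p‖ < 1) (hp0 : p ≠ 0) (hv : v ≠ 0) :
    Summable (thetaTerm p v) := by
  refine Summable.of_nat_of_neg (summable_thetaTerm_nat hp hp0 hv) ?_
  refine (summable_thetaTerm_nat hp hp0 (div_ne_zero hp0 hv)).congr fun n => ?_
  have hexp : -(n : ℤ) * (-(n : ℤ) - 1) / 2 = (n : ℤ) * (n - 1) / 2 + n := by
    have h1 := two_mul_triangle (-(n : ℤ))
    have h2 := two_mul_triangle (n : ℤ)
    linarith
  rw [thetaTerm, thetaTerm, hexp, zpow_add₀ hp0, div_zpow, zpow_neg]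
  ring

theorem prod_one_add_mul_pow_div {p v : ℂ} (hp0 : p ≠ 0) (hv : v ≠ 0) (n : ℕ) :
    p ^ ((n + 1).choose 2) * ∏ i ∈ Finset.range n, (1 + v / p ^ n * p ^ i) =
      v ^ n * ∏ i ∈ Finset.range n, (1 + p / v * p ^ i) := by
  induction n with
  | zero => simp
  | succ n ih =>
    have hshift : ∀ i ∈ Finset.range n,
        1 + v / p ^ (n + 1) * p ^ (i + 1) = 1 + v / p ^ n * p ^ i := by
      intro i _
      rw [pow_succ, pow_succ]
      field_simp
    have hch : (n + 1 + 1).choose 2 = (n + 1) + (n + 1).choose 2 := by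
      rw [Nat.choose_succ_succ' (n + 1) 1, Nat.choose_one_right]
    rw [Finset.prod_range_succ', Finset.prod_range_succ, Finset.prod_congr rfl hshift, hch,
      pow_add, pow_succ v]
    calc _ = p ^ ((n + 1).choose 2) * (∏ i ∈ Finset.range n, (1 + v / p ^ n * p ^ i)) *
          (p ^ (n + 1) * (1 + v / p ^ (n + 1) * p ^ 0)) := by ring
      _ = _ := by
        rw [ih]
        field_simp
        ring

/-- Summand of the finite form of the triple product identity. -/
def finiteThetaTerm (p v : ℂ) (n : ℕ) (m : ℤ) : ℂ :=
  if m ∈ Finset.Icc (-(n : ℤ)) n then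
    gaussBinom p (n + n) ((n : ℤ) + m).toNat * thetaTerm p v m else 0

/-- The finite form of the Jacobi triple product identity. -/
theorem qPoch_mul_qPoch_eq_tsum {p v : ℂ} (hp : ‖p‖ < 1) (hp0 : p ≠ 0) (hv : v ≠ 0) (n : ℕ) :
    qPoch (-v) p n * qPoch (p / -v) p n = ∑' m : ℤ, finiteThetaTerm p v n m := by
  have hl : qPoch (-v) p n = ∏ i ∈ Finset.range n, (1 + v / p ^ n * p ^ (n + i)) := by
    refine Finset.prod_congr rfl fun i _ => ?_
    rw [pow_add]
    field_simp
    ring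
  have hr : qPoch (p / -v) p n = ∏ i ∈ Finset.range n, (1 + p / v * p ^ i) := by
    refine Finset.prod_congr rfl fun i _ => ?_
    rw [div_neg]
    ring
  have hsplit := prod_one_add_mul_pow hp (v / p ^ n) (n + n)
  rw [Finset.prod_range_add, ← hl] at hsplit
  have hdiv := prod_one_add_mul_pow_div hp0 hv n
  rw [← hr] at hdiv
  rw [tsum_eq_sum (f := finiteThetaTerm p v n) (s := Finset.Icc (-(n : ℤ)) n)
    fun m hm => if_neg hm]
  have hvn : v ^ n ≠ 0 := pow_ne_zero _ hv
  refine mul_left_cancel₀ hvn ?_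
  calc v ^ n * (qPoch (-v) p n * qPoch (p / -v) p n)
      = p ^ ((n + 1).choose 2) *
        ∑ k ∈ Finset.range (n + n + 1),
          p ^ (k.choose 2) * gaussBinom p (n + n) k * (v / p ^ n) ^ k := by
        rw [← hsplit]
        linear_combination (-qPoch (-v) p n) * hdiv
    _ = v ^ n * ∑ m ∈ Finset.Icc (-(n : ℤ)) n, finiteThetaTerm p v n m := by
        rw [Finset.mul_sum, Finset.mul_sum]
        refine Finset.sum_nbij' (fun k : ℕ => (k : ℤ) - n) (fun m : ℤ => ((n : ℤ) + m).toNat)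
          ?_ ?_ ?_ ?_ ?_
        · intro k hk
          simp only [Finset.mem_range, Finset.mem_Icc] at hk ⊢
          omega
        · intro m hm
          simp only [Finset.mem_range, Finset.mem_Icc] at hm ⊢
          omega
        · intro k _
          simp
        · intro m hm
          simp only [Finset.mem_Icc] at hm
          omega
        · intro k hk
          have hmem : (k : ℤ) - n ∈ Finset.Icc (-(n : ℤ)) n := by
            simp only [Finset.mem_range, Finset.mem_Icc] at hk ⊢
            omega
          have hk' : ((n : ℤ) + (k - n)).toNat = k := by omega
          have hexp : (((n + 1).choose 2 : ℕ) : ℤ) + ((k.choose 2 : ℕ) : ℤ) =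
              ((k : ℤ) - n) * ((k : ℤ) - n - 1) / 2 + ((n * k : ℕ) : ℤ) := by
            have h1 := two_mul_cast_choose_two (n + 1)
            have h2 := two_mul_cast_choose_two k
            have h3 := two_mul_triangle ((k : ℤ) - n)
            push_cast at h1 ⊢
            linarith
          have hpow : p ^ ((n + 1).choose 2) * p ^ (k.choose 2) =
              p ^ (((k : ℤ) - n) * ((k : ℤ) - n - 1) / 2) * p ^ (n * k) := by
            rw [← zpow_natCast, ← zpow_natCast, ← zpow_natCast, ← zpow_add₀ hp0,
              ← zpow_add₀ hp0, hexp]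
          rw [finiteThetaTerm, if_pos hmem, hk', thetaTerm, zpow_sub₀ hv, zpow_natCast,
            zpow_natCast, div_pow, ← pow_mul]
          have hpnk : p ^ (n * k) ≠ 0 := pow_ne_zero _ hp0
          field_simp
          linear_combination gaussBinom p (n + n) k * hpow

theorem exists_norm_gaussBinom_le {p : ℂ} (hp : ‖p‖ < 1) :
    ∃ M : ℝ, ∀ n k, ‖gaussBinom p n k‖ ≤ M := by
  obtain ⟨A, hA⟩ := (Metric.isBounded_range_of_tendsto _ (tendsto_qPoch hp p)).exists_norm_le
  obtain ⟨B, hB⟩ := (Metric.isBounded_range_of_tendsto _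
    ((tendsto_qPoch hp p).inv₀ (qPochInf_self_ne_zero hp))).exists_norm_le
  have hA' : ∀ n, ‖qPoch p p n‖ ≤ A := fun n => hA _ ⟨n, rfl⟩
  have hB' : ∀ n, ‖(qPoch p p n)⁻¹‖ ≤ B := fun n => hB _ ⟨n, rfl⟩
  have hA0 : 0 ≤ A := (norm_nonneg _).trans (hA' 0)
  have hB0 : 0 ≤ B := (norm_nonneg _).trans (hB' 0)
  refine ⟨A * (B * B), fun n k => ?_⟩
  rw [gaussBinom]
  split_ifs
  · rw [div_eq_mul_inv, mul_inv, norm_mul, norm_mul]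
    exact mul_le_mul (hA' _) (mul_le_mul (hB' _) (hB' _) (norm_nonneg _) hB0) (by positivity) hA0
  · rw [norm_zero]
    positivity

theorem tendsto_finiteThetaTerm {p : ℂ} (hp : ‖p‖ < 1) (v : ℂ) (m : ℤ) :
    Tendsto (fun n => finiteThetaTerm p v n m) atTop
      (𝓝 ((qPochInf p p)⁻¹ * thetaTerm p v m)) := by
  have hC := qPochInf_self_ne_zero hp
  have h1 : Tendsto (fun n : ℕ => n + n) atTop atTop :=
    tendsto_atTop_mono (fun n => Nat.le_add_left n n) tendsto_id
  have h2 : Tendsto (fun n : ℕ => ((n : ℤ) + m).toNat) atTop atTop := by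
    refine tendsto_atTop.mpr fun b => ?_
    filter_upwards [eventually_ge_atTop (b + m.natAbs)] with n hn
    omega
  have h3 : Tendsto (fun n : ℕ => ((n : ℤ) - m).toNat) atTop atTop := by
    refine tendsto_atTop.mpr fun b => ?_
    filter_upwards [eventually_ge_atTop (b + m.natAbs)] with n hn
    omega
  have hq := tendsto_qPoch hp p
  have hlim := (((hq.comp h1).div ((hq.comp h2).mul (hq.comp h3))
    (mul_ne_zero hC hC)).mul_const (thetaTerm p v m))
  have hval : qPochInf p p / (qPochInf p p * qPochInf p p) = (qPochInf p p)⁻¹ := by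
    field_simp
  rw [hval] at hlim
  refine hlim.congr' ?_
  filter_upwards [eventually_ge_atTop m.natAbs] with n hn
  have hmem : m ∈ Finset.Icc (-(n : ℤ)) n := by
    rw [Finset.mem_Icc]
    omega
  have hle : ((n : ℤ) + m).toNat ≤ n + n := by omega
  have hsub : n + n - ((n : ℤ) + m).toNat = ((n : ℤ) - m).toNat := by omega
  simp only [finiteThetaTerm, if_pos hmem, gaussBinom, if_pos hle, hsub, Function.comp_apply,
    Pi.div_apply]

/-- The Jacobi triple product identity. -/
theorem qPochInf_mul_theta_neg {p v : ℂ} (hp : ‖p‖ < 1) (hp0 : p ≠ 0) (hv : v ≠ 0) :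
    qPochInf p p * theta (-v) p = thetaSeries p v := by
  obtain ⟨M, hM⟩ := exists_norm_gaussBinom_le hp
  have hM0 : 0 ≤ M := (norm_nonneg _).trans (hM 0 0)
  have hseries : Tendsto (fun n => ∑' m : ℤ, finiteThetaTerm p v n m) atTop
      (𝓝 (∑' m : ℤ, (qPochInf p p)⁻¹ * thetaTerm p v m)) := by
    refine tendsto_tsum_of_dominated_convergence (bound := fun m => M * ‖thetaTerm p v m‖)
      ((summable_thetaTerm hp hp0 hv).norm.mul_left M) (tendsto_finiteThetaTerm hp v)
      (.of_forall fun n m => ?_)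
    rw [finiteThetaTerm]
    split_ifs
    · rw [norm_mul]
      exact mul_le_mul_of_nonneg_right (hM _ _) (norm_nonneg _)
    · rw [norm_zero]
      positivity
  have hprod := (tendsto_qPoch hp (-v)).mul (tendsto_qPoch hp (p / -v))
  have heq := tendsto_nhds_unique
    (hprod.congr fun n => qPoch_mul_qPoch_eq_tsum hp hp0 hv n) hseries
  rw [tsum_mul_left] at heq
  rw [theta, heq, mul_inv_cancel_left₀ (qPochInf_self_ne_zero hp), thetaSeries]

/-- Splitting of `ℤ × ℤ` according to the parity of the sum of the coordinates. -/
def parityEquiv : (ℤ × ℤ) ⊕ (ℤ × ℤ) ≃ ℤ × ℤ :=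
  Equiv.ofBijective
    (Sum.elim (fun x => (x.1 + x.2, x.1 - x.2)) fun x => (x.1 + x.2 + 1, x.1 - x.2)) <| by
    constructor
    · rintro (⟨r, s⟩ | ⟨r, s⟩) (⟨r', s'⟩ | ⟨r', s'⟩) h <;>
        simp only [Sum.elim_inl, Sum.elim_inr, Prod.mk.injEq, Sum.inl.injEq, Sum.inr.injEq,
          reduceCtorEq] at h ⊢ <;> omega
    · rintro ⟨m, n⟩
      rcases Int.even_or_odd (m + n) with ⟨r, hr⟩ | ⟨r, hr⟩
      · exact ⟨.inl (r, m - r), by simp only [Sum.elim_inl, Prod.mk.injEq]; omega⟩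
      · exact ⟨.inr (r, m - r - 1), by simp only [Sum.elim_inr, Prod.mk.injEq]; omega⟩

theorem thetaTerm_mul_even {p v w : ℂ} (hp0 : p ≠ 0) (hv : v ≠ 0) (hw : w ≠ 0) (r s : ℤ) :
    thetaTerm p v (r + s) * thetaTerm p w (r - s) =
      thetaTerm (p ^ 2) (v * w) r * thetaTerm (p ^ 2) (p * v / w) s := by
  have hexp : (r + s) * (r + s - 1) / 2 + (r - s) * (r - s - 1) / 2 =
      2 * (r * (r - 1) / 2) + 2 * (s * (s - 1) / 2) + s := by
    have h1 := two_mul_triangle (r + s)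
    have h2 := two_mul_triangle (r - s)
    have h3 := two_mul_triangle r
    have h4 := two_mul_triangle s
    linarith
  have hpow := congrArg (fun e : ℤ => p ^ e) hexp
  simp only [zpow_add₀ hp0, zpow_mul, zpow_ofNat] at hpow
  simp only [thetaTerm, div_zpow, mul_zpow, zpow_add₀ hv, zpow_sub₀ hw]
  linear_combination (v ^ r * v ^ s * w ^ r / w ^ s) * hpow

theorem thetaTerm_mul_odd {p v w : ℂ} (hp0 : p ≠ 0) (hv : v ≠ 0) (hw : w ≠ 0) (r s : ℤ) :
    thetaTerm p v (r + s + 1) * thetaTerm p w (r - s) =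
      v * (thetaTerm (p ^ 2) (p * v * w) r * thetaTerm (p ^ 2) (p ^ 2 * v / w) s) := by
  have hexp : (r + s + 1) * (r + s + 1 - 1) / 2 + (r - s) * (r - s - 1) / 2 =
      2 * (r * (r - 1) / 2) + 2 * (s * (s - 1) / 2) + r + 2 * s := by
    have h1 := two_mul_triangle (r + s + 1)
    have h2 := two_mul_triangle (r - s)
    have h3 := two_mul_triangle r
    have h4 := two_mul_triangle s
    linarith
  have hpow := congrArg (fun e : ℤ => p ^ e) hexp
  simp only [zpow_add₀ hp0, zpow_mul, zpow_ofNat] at hpow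
  simp only [thetaTerm, div_zpow, mul_zpow, zpow_add₀ hv, zpow_sub₀ hw, zpow_one]
  linear_combination (v * v ^ r * v ^ s * w ^ r / w ^ s) * hpow

theorem thetaSeries_mul {p v w : ℂ} (hp : ‖p‖ < 1) (hp0 : p ≠ 0) (hv : v ≠ 0) (hw : w ≠ 0) :
    thetaSeries p v * thetaSeries p w =
      thetaSeries (p ^ 2) (v * w) * thetaSeries (p ^ 2) (p * v / w) +
        v * (thetaSeries (p ^ 2) (p * v * w) * thetaSeries (p ^ 2) (p ^ 2 * v / w)) := by
  have hs : ∀ {z : ℂ}, z ≠ 0 → Summable fun m => ‖thetaTerm p z m‖ := fun hz =>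
    (summable_thetaTerm hp hp0 hz).norm
  have hs2 : ∀ {z : ℂ}, z ≠ 0 → Summable fun m => ‖thetaTerm (p ^ 2) z m‖ := fun hz =>
    (summable_thetaTerm (norm_sq_lt_one hp) (pow_ne_zero 2 hp0) hz).norm
  have hsum := summable_mul_of_summable_norm (hs hv) (hs hw)
  have hsum' := (parityEquiv.summable_iff (f := fun x : ℤ × ℤ =>
    thetaTerm p v x.1 * thetaTerm p w x.2)).mpr hsum
  have h1 : v * w ≠ 0 := mul_ne_zero hv hw
  have h2 : p * v / w ≠ 0 := div_ne_zero (mul_ne_zero hp0 hv) hw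
  have h3 : p * v * w ≠ 0 := mul_ne_zero (mul_ne_zero hp0 hv) hw
  have h4 : p ^ 2 * v / w ≠ 0 := div_ne_zero (mul_ne_zero (pow_ne_zero 2 hp0) hv) hw
  simp only [thetaSeries]
  rw [tsum_mul_tsum_of_summable_norm (hs hv) (hs hw),
    tsum_mul_tsum_of_summable_norm (hs2 h1) (hs2 h2),
    tsum_mul_tsum_of_summable_norm (hs2 h3) (hs2 h4), ← tsum_mul_left,
    ← parityEquiv.tsum_eq]
  refine (Summable.tsum_sum (hsum'.comp_injective Sum.inl_injective)
      (hsum'.comp_injective Sum.inr_injective)).trans ?_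
  congr 1
  · exact tsum_congr fun x => thetaTerm_mul_even hp0 hv hw x.1 x.2
  · exact tsum_congr fun x => thetaTerm_mul_odd hp0 hv hw x.1 x.2

/-- The product of two theta functions in terms of theta functions of the squared nome. -/
theorem theta_mul_theta {p : ℂ} (hp : ‖p‖ < 1) (hp0 : p ≠ 0) :
    ∃ κ : ℂ, ∀ x y : ℂ, x ≠ 0 → y ≠ 0 →
      theta x p * theta y p = κ *
        (theta (-(x * y)) (p ^ 2) * theta (-(p * x / y)) (p ^ 2) -
          y * (theta (-(p * x * y)) (p ^ 2) * theta (-(x / y)) (p ^ 2))) := by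
  have hC := qPochInf_self_ne_zero hp
  have hp2 := norm_sq_lt_one hp
  have hp20 : p ^ 2 ≠ 0 := pow_ne_zero 2 hp0
  refine ⟨qPochInf (p ^ 2) (p ^ 2) ^ 2 / qPochInf p p ^ 2, fun x y hx hy => ?_⟩
  have hmul := thetaSeries_mul hp hp0 (neg_ne_zero.mpr hx) (neg_ne_zero.mpr hy)
  have e1 : -x * -y = x * y := by ring
  have e2 : p * -x / -y = p * x / y := by field_simp
  have e3 : p * -x * -y = p * x * y := by ring
  have e4 : p ^ 2 * -x / -y = p ^ 2 * (x / y) := by field_simp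
  have e5 : -(p ^ 2 * (x / y)) = p ^ 2 * -(x / y) := by ring
  rw [e1, e2, e3, e4, ← qPochInf_mul_theta_neg hp hp0 (neg_ne_zero.mpr hx),
    ← qPochInf_mul_theta_neg hp hp0 (neg_ne_zero.mpr hy),
    ← qPochInf_mul_theta_neg hp2 hp20 (by positivity),
    ← qPochInf_mul_theta_neg hp2 hp20 (by positivity),
    ← qPochInf_mul_theta_neg hp2 hp20 (by positivity),
    ← qPochInf_mul_theta_neg hp2 hp20 (by positivity),
    neg_neg, neg_neg, e5, theta_mul hp2 hp20 (neg_ne_zero.mpr (div_ne_zero hx hy))] at hmul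
  field_simp at hmul ⊢
  linear_combination hmul

/-- Weierstrass' three-term addition formula. -/
theorem theta_three_term {p : ℂ} (hp : ‖p‖ < 1) (hp0 : p ≠ 0) {x y u v : ℂ}
    (hx : x ≠ 0) (hy : y ≠ 0) (hu : u ≠ 0) (hv : v ≠ 0) :
    y * (theta (x * y) p * theta (x / y) p * theta (u * v) p * theta (u / v) p) -
      u * (theta (x * u) p * theta (x / u) p * theta (y * v) p * theta (y / v) p) +
      u * (theta (x * v) p * theta (x / v) p * theta (y * u) p * theta (y / u) p) = 0 := by
  obtain ⟨κ, hκ⟩ := theta_mul_theta hp hp0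
  have hpair : ∀ {s t : ℂ}, s ≠ 0 → t ≠ 0 → theta (s * t) p * theta (s / t) p = κ *
      (theta (-s ^ 2) (p ^ 2) * theta (-(p * t ^ 2)) (p ^ 2) -
        s / t * (theta (-(p * s ^ 2)) (p ^ 2) * theta (-t ^ 2) (p ^ 2))) := by
    intro s t hs ht
    have e1 : s * t * (s / t) = s ^ 2 := by field_simp
    have e2 : p * (s * t) / (s / t) = p * t ^ 2 := by field_simp
    have e3 : p * (s * t) * (s / t) = p * s ^ 2 := by field_simp
    have e4 : s * t / (s / t) = t ^ 2 := by field_simp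
    rw [hκ _ _ (mul_ne_zero hs ht) (div_ne_zero hs ht), e1, e2, e3, e4]
  have regroup : ∀ k l m n : ℂ, k * l * m * n = k * l * (m * n) := fun k l m n => by ring
  rw [regroup, regroup, regroup, hpair hx hy, hpair hu hv, hpair hx hu, hpair hy hv,
    hpair hx hv, hpair hy hu]
  field_simp
  ring

theorem theta_quadratic_difference {q h a b c d : ℂ} (hq : ‖q‖ < 1) (hh : h ^ 2 = q)
    (h0 : h ≠ 0) (ha : a ≠ 0) (hb : b ≠ 0) (hc : c ≠ 0) (hd : d ≠ 0) :
    theta (-(h * a * b * c)) q * theta (-(h * b * d)) q *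
        theta (-(q * b ^ 2 / (a * c * d))) (q ^ 2) -
      theta (-(q * a * b ^ 2 * c * d)) (q ^ 2) * theta (-(h * b / (a * c))) q *
        theta (-(h * d / b)) q =
    h / (a * b * c) * (theta (a * c * d) q * theta (b ^ 2) q * theta (-(a * c / d)) (q ^ 2)) := by
  have hq0 : q ≠ 0 := hh ▸ pow_ne_zero 2 h0
  obtain ⟨κ, hκ⟩ := theta_mul_theta hq hq0
  have hx := hκ (-(h * a * b * c)) (-(h * b * d))
    (neg_ne_zero.mpr (by positivity)) (neg_ne_zero.mpr (by positivity))
  have hx' := hκ (-(h * a * c / b)) (-(h * d / b))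
    (neg_ne_zero.mpr (by positivity)) (neg_ne_zero.mpr (by positivity))
  have hz := hκ (a * c * d) (b ^ 2) (by positivity) (by positivity)
  have e1 : -(-(h * a * b * c) * -(h * b * d)) = -(q * a * b ^ 2 * c * d) := by
    rw [← hh]; ring
  have e2 : -(q * -(h * a * b * c) / -(h * b * d)) = -(q * a * c / d) := by field_simp
  have e3 : -(q * -(h * a * b * c) * -(h * b * d)) = q ^ 2 * -(a * c * d * b ^ 2) := by
    rw [← hh]; ring
  have e4 : -(-(h * a * b * c) / -(h * b * d)) = -(a * c / d) := by field_simp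
  have e1' : -(-(h * a * c / b) * -(h * d / b)) = -(q * (a * c * d) / b ^ 2) := by
    rw [← hh]; field_simp
  have e2' : -(q * -(h * a * c / b) / -(h * d / b)) = -(q * a * c / d) := by field_simp
  have e3' : -(q * -(h * a * c / b) * -(h * d / b)) = q ^ 2 * -(a * c * d / b ^ 2) := by
    rw [← hh]; field_simp
  have e4' : -(-(h * a * c / b) / -(h * d / b)) = -(a * c / d) := by field_simp
  have e5 : -(q * (a * c * d) * b ^ 2) = -(q * a * b ^ 2 * c * d) := by ring
  have e6 : theta (-(q * b ^ 2 / (a * c * d))) (q ^ 2) =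
      theta (-(q * (a * c * d) / b ^ 2)) (q ^ 2) := by
    rw [← theta_div (pow_ne_zero 2 hq0)]
    congr 1
    field_simp
  have e7 : theta (-(h * b / (a * c))) q = theta (-(h * a * c / b)) q := by
    rw [← theta_div hq0]
    congr 1
    rw [← hh]
    field_simp
  rw [e1, e2, e3, e4, theta_mul (norm_sq_lt_one hq) (pow_ne_zero 2 hq0)
    (neg_ne_zero.mpr (by positivity))] at hx
  rw [e1', e2', e3', e4', theta_mul (norm_sq_lt_one hq) (pow_ne_zero 2 hq0)
    (neg_ne_zero.mpr (by positivity))] at hx'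
  rw [e5] at hz
  rw [e6, e7, mul_assoc (theta (-(q * a * b ^ 2 * c * d)) (q ^ 2)), hx, hx', hz]
  field_simp
  ring

theorem theta_three_term_half_base {q h a b c d : ℂ} (hq : ‖q‖ < 1) (hh : h ^ 2 = q)
    (h0 : h ≠ 0) (ha : a ≠ 0) (hb : b ≠ 0) (hc : c ≠ 0) (hd : d ≠ 0) :
    theta (-(h * a * b * c)) q * theta (-(q * c / (a * d))) (q ^ 2) *
        theta (-(q * a / (b ^ 2 * c * d))) (q ^ 2) -
      theta (-(q * a * b ^ 2 * c * d)) (q ^ 2) * theta (-(q * (a * c / d))) (q ^ 2) *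
        theta (-(h * a / (b * c))) q =
    h / (a * b * c) * (theta (b ^ 2 * c ^ 2) (q ^ 2) * theta (a ^ 2) (q ^ 2) *
      theta (h * b * d) q) := by
  have hq0 : q ≠ 0 := hh ▸ pow_ne_zero 2 h0
  have hq2 := norm_sq_lt_one hq
  have hq20 : q ^ 2 ≠ 0 := pow_ne_zero 2 hq0
  obtain ⟨x, hx⟩ := IsAlgClosed.exists_pow_nat_eq (b * c ^ 2 / (h * d)) two_pos
  have hx0 : x ≠ 0 := by
    rintro rfl
    rw [zero_pow two_ne_zero] at hx
    exact absurd hx.symm (by positivity)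
  have hd' : d = b * c ^ 2 / (h * x ^ 2) := by
    rw [hx]; field_simp
  have hy0 : -(h * a * b * c / x) ≠ 0 := neg_ne_zero.mpr (by positivity)
  have hu0 : -(h ^ 3 * a * x / (b * c)) ≠ 0 := neg_ne_zero.mpr (by positivity)
  have hv0 : b ^ 2 * c ^ 2 / x ≠ 0 := by positivity
  have key := theta_three_term hq2 hq20 hx0 hy0 hu0 hv0
  have e1 : x * -(h * a * b * c / x) = -(h * a * b * c) := by field_simp
  have e2 : x / -(h * a * b * c / x) = (-(q * a * d / c))⁻¹ := by
    rw [hd', ← hh]; field_simp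
  have e3 : -(h ^ 3 * a * x / (b * c)) * (b ^ 2 * c ^ 2 / x) = q * -(h * a * b * c) := by
    rw [← hh]; field_simp
  have e4 : -(h ^ 3 * a * x / (b * c)) / (b ^ 2 * c ^ 2 / x) = -(q * a / (b ^ 2 * c * d)) := by
    rw [hd', ← hh]; field_simp
  have e5 : x * -(h ^ 3 * a * x / (b * c)) = -(q * (a * c / d)) := by
    rw [hd', ← hh]; field_simp
  have e6 : x / -(h ^ 3 * a * x / (b * c)) = (q * -(h * a / (b * c)))⁻¹ := by
    rw [← hh]; field_simp
  have e7 : -(h * a * b * c / x) * (b ^ 2 * c ^ 2 / x) = -(q * a * b ^ 2 * c * d) := by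
    rw [hd', ← hh]; field_simp
  have e8 : -(h * a * b * c / x) / (b ^ 2 * c ^ 2 / x) = -(h * a / (b * c)) := by field_simp
  have e9 : x * (b ^ 2 * c ^ 2 / x) = b ^ 2 * c ^ 2 := by field_simp
  have e10 : x / (b ^ 2 * c ^ 2 / x) = (h * b * d)⁻¹ := by
    rw [hd']; field_simp
  have e11 : -(h * a * b * c / x) * -(h ^ 3 * a * x / (b * c)) = q ^ 2 * a ^ 2 := by
    rw [← hh]; field_simp
  have e12 : -(h * a * b * c / x) / -(h ^ 3 * a * x / (b * c)) = b * d / h := by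
    rw [hd']; field_simp
  have e13 : theta (-(q * c / (a * d))) (q ^ 2) = theta (-(q * a * d / c)) (q ^ 2) := by
    rw [← theta_div hq20]
    congr 1
    field_simp
  have e14 : q * (h * b * d) = q ^ 2 * (b * d / h) := by
    rw [← hh]; field_simp
  have hw0 : -(h * a / (b * c)) ≠ 0 := neg_ne_zero.mpr (by positivity)
  rw [e1, e2, e3, e4, e5, e6, e7, e8, e9, e10, e11, e12,
    theta_inv hq2 (neg_ne_zero.mpr (by positivity)), theta_inv hq2 (mul_ne_zero hq0 hw0),
    theta_inv hq2 (by positivity), theta_mul hq2 hq20 (by positivity)] at key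
  rw [e13, theta_eq_sq_base hq hq0 (u := -(h * a * b * c)) (neg_ne_zero.mpr (by positivity)),
    theta_eq_sq_base hq hq0 hw0, theta_eq_sq_base hq hq0 (u := h * b * d) (by positivity), e14,
    theta_mul hq2 hq20 (u := b * d / h) (by positivity)]
  generalize theta (-(h * a * b * c)) (q ^ 2) = t1 at key ⊢
  generalize theta (q * -(h * a * b * c)) (q ^ 2) = t2 at key ⊢
  generalize theta (-(q * a * d / c)) (q ^ 2) = t3 at key ⊢
  generalize theta (-(q * a / (b ^ 2 * c * d))) (q ^ 2) = t4 at key ⊢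
  generalize theta (-(q * (a * c / d))) (q ^ 2) = t5 at key ⊢
  generalize theta (q * -(h * a / (b * c))) (q ^ 2) = t6 at key ⊢
  generalize theta (-(q * a * b ^ 2 * c * d)) (q ^ 2) = t7 at key ⊢
  generalize theta (-(h * a / (b * c))) (q ^ 2) = t8 at key ⊢
  generalize theta (b ^ 2 * c ^ 2) (q ^ 2) = t9 at key ⊢
  generalize theta (h * b * d) (q ^ 2) = t10 at key ⊢
  generalize theta (a ^ 2) (q ^ 2) = t11 at key ⊢
  generalize theta (b * d / h) (q ^ 2) = t12 at key ⊢
  subst hd' hh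
  field_simp at key ⊢
  refine mul_left_cancel₀ hx0 ?_
  linear_combination -key

theorem theta_quadratic_identity {q h a b c d : ℂ} (hq : ‖q‖ < 1) (hh : h ^ 2 = q)
    (h0 : h ≠ 0) (ha : a ≠ 0) (hb : b ≠ 0) (hc : c ≠ 0) (hd : d ≠ 0)
    (h1 : theta (q * a ^ 2) (q ^ 2) ≠ 0) (h2 : theta (-(h * a * b * c)) q ≠ 0) :
    theta (a ^ 2) (q ^ 2) * theta (b ^ 2 * c ^ 2) (q ^ 2) * theta (-b ^ 2) (q ^ 2) *
        theta (q * b ^ 2 * d ^ 2) (q ^ 2) * theta (-(q * b ^ 2 / (a * c * d))) (q ^ 2) *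
        theta (-(q * b ^ 2)) (q ^ 2) -
      theta (b ^ 4) (q ^ 2) * theta (-(q * c / (a * d))) (q ^ 2) * theta (a * c * d) (q ^ 2) *
        theta (-(a * c / d)) (q ^ 2) * theta (q * a * c * d) (q ^ 2) *
        theta (-(q * a / (b ^ 2 * c * d))) (q ^ 2) =
    theta (-(q * a * b ^ 2 * c * d)) (q ^ 2) * theta (-b ^ 2) q /
        (theta (q * a ^ 2) (q ^ 2) * theta (-(h * a * b * c)) q) *
      (theta (b * c) q * theta (-(b * c)) q * theta (a ^ 2) q * theta (h * b * d) q *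
          theta (-(h * b / (a * c))) q * theta (-(h * d / b)) q -
        theta (b ^ 2) q * theta (-(h * a)) q * theta (a * c * d) q * theta (-(a * c / d)) q *
          theta (h * a) q * theta (-(h * a / (b * c))) q) := by
  have hq0 : q ≠ 0 := hh ▸ pow_ne_zero 2 h0
  have f1 : theta (b ^ 2 * c ^ 2) (q ^ 2) = theta (b * c) q * theta (-(b * c)) q := by
    rw [← theta_sq hq, mul_pow]
  have f2 : theta (-b ^ 2) q = theta (-b ^ 2) (q ^ 2) * theta (-(q * b ^ 2)) (q ^ 2) := by
    rw [theta_eq_sq_base hq hq0 (neg_ne_zero.mpr (by positivity)), mul_neg]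
  have f3 : theta (q * b ^ 2 * d ^ 2) (q ^ 2) = theta (h * b * d) q * theta (-(h * b * d)) q := by
    rw [← theta_sq hq, mul_pow, mul_pow, hh]
  have f4 : theta (b ^ 4) (q ^ 2) = theta (b ^ 2) q * theta (-b ^ 2) q := by
    rw [← theta_sq hq, ← pow_mul]
  have f5 : theta (a * c * d) q =
      theta (a * c * d) (q ^ 2) * theta (q * a * c * d) (q ^ 2) := by
    rw [theta_eq_sq_base hq hq0 (by positivity), mul_assoc q a c, mul_assoc q (a * c) d]
  have f6 : theta (a ^ 2) q = theta (a ^ 2) (q ^ 2) * theta (q * a ^ 2) (q ^ 2) :=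
    theta_eq_sq_base hq hq0 (by positivity)
  have f7 : theta (h * a) q * theta (-(h * a)) q = theta (q * a ^ 2) (q ^ 2) := by
    rw [← theta_sq hq, mul_pow, hh]
  have f8 : theta (-(a * c / d)) q =
      theta (-(a * c / d)) (q ^ 2) * theta (-(q * (a * c / d))) (q ^ 2) := by
    rw [theta_eq_sq_base hq hq0 (neg_ne_zero.mpr (by positivity)), mul_neg]
  have g1 := theta_quadratic_difference hq hh h0 ha hb hc hd
  have g2 := theta_three_term_half_base hq hh h0 ha hb hc hd
  rw [f1] at g2
  rw [div_mul_eq_mul_div, eq_div_iff (mul_ne_zero h1 h2), f1, f3, f4, f6, f8, f2]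
  rw [f5] at g1 ⊢
  linear_combination
    theta (-b ^ 2) (q ^ 2) * theta (-(q * b ^ 2)) (q ^ 2) *
      (theta (b * c) q * theta (-(b * c)) q * theta (a ^ 2) (q ^ 2) *
        theta (q * a ^ 2) (q ^ 2) * theta (h * b * d) q * g1 -
      theta (b ^ 2) q * theta (a * c * d) (q ^ 2) * theta (q * a * c * d) (q ^ 2) *
        theta (-(a * c / d)) (q ^ 2) * theta (q * a ^ 2) (q ^ 2) * g2 +
      theta (b ^ 2) q * theta (a * c * d) (q ^ 2) * theta (q * a * c * d) (q ^ 2) *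
        theta (-(a * c / d)) (q ^ 2) * theta (-(q * (a * c / d))) (q ^ 2) *
        theta (-(h * a / (b * c))) q * theta (-(q * a * b ^ 2 * c * d)) (q ^ 2) * f7)

/-- the quadratic-type theta function identity (with
`Real.sqrt q = q^{1/2}` the positive square root). -/
theorem stmt19 (q : ℝ) (hq0 : 0 < q) (hq1 : q < 1) (a b c d : ℂ)
    (ha : a ≠ 0) (hb : b ≠ 0) (hc : c ≠ 0) (hd : d ≠ 0)
    (h1 : theta ((q : ℂ) * a ^ 2) ((q : ℂ) ^ 2) ≠ 0)
    (h2 : theta (-((Real.sqrt q : ℂ) * a * b * c)) (q : ℂ) ≠ 0) :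
    theta (a ^ 2) ((q : ℂ) ^ 2) * theta (b ^ 2 * c ^ 2) ((q : ℂ) ^ 2) *
        theta (-b ^ 2) ((q : ℂ) ^ 2) * theta ((q : ℂ) * b ^ 2 * d ^ 2) ((q : ℂ) ^ 2) *
        theta (-((q : ℂ) * b ^ 2 / (a * c * d))) ((q : ℂ) ^ 2) *
        theta (-((q : ℂ) * b ^ 2)) ((q : ℂ) ^ 2) -
      theta (b ^ 4) ((q : ℂ) ^ 2) * theta (-((q : ℂ) * c / (a * d))) ((q : ℂ) ^ 2) *
        theta (a * c * d) ((q : ℂ) ^ 2) * theta (-(a * c / d)) ((q : ℂ) ^ 2) *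
        theta ((q : ℂ) * a * c * d) ((q : ℂ) ^ 2) *
        theta (-((q : ℂ) * a / (b ^ 2 * c * d))) ((q : ℂ) ^ 2) =
    theta (-((q : ℂ) * a * b ^ 2 * c * d)) ((q : ℂ) ^ 2) * theta (-b ^ 2) (q : ℂ) /
        (theta ((q : ℂ) * a ^ 2) ((q : ℂ) ^ 2) *
          theta (-((Real.sqrt q : ℂ) * a * b * c)) (q : ℂ)) *
      (theta (b * c) (q : ℂ) * theta (-(b * c)) (q : ℂ) * theta (a ^ 2) (q : ℂ) *
          theta ((Real.sqrt q : ℂ) * b * d) (q : ℂ) *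
          theta (-((Real.sqrt q : ℂ) * b / (a * c))) (q : ℂ) *
          theta (-((Real.sqrt q : ℂ) * d / b)) (q : ℂ) -
        theta (b ^ 2) (q : ℂ) * theta (-((Real.sqrt q : ℂ) * a)) (q : ℂ) *
          theta (a * c * d) (q : ℂ) * theta (-(a * c / d)) (q : ℂ) *
          theta ((Real.sqrt q : ℂ) * a) (q : ℂ) *
          theta (-((Real.sqrt q : ℂ) * a / (b * c))) (q : ℂ)) := by
  have hh : (Real.sqrt q : ℂ) ^ 2 = (q : ℂ) := by
    rw [← Complex.ofReal_pow, Real.sq_sqrt hq0.le]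
  have h0 : (Real.sqrt q : ℂ) ≠ 0 := Complex.ofReal_ne_zero.mpr (Real.sqrt_ne_zero'.mpr hq0)
  have hq : ‖(q : ℂ)‖ < 1 := by
    rwa [Complex.norm_real, Real.norm_of_nonneg hq0.le]
  exact theta_quadratic_identity hq hh h0 ha hb hc hd h1 h2

end
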